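/- For every integer n ≥ 0, P_{n+1}(q) = Σ_{j=0}^{n} Σ_{k=0}^{j} q^{(j²+j+k²−k)/2} · [j choose k]_q · [n−k choose j]_q in ℤ[q]. -/

import Mathlib

open Polynomial

/-- The q-Pell polynomials: P₀ = 0, P₁ = 1, Pₙ = (1+q^(n-1)) Pₙ₋₁ + q^(n-2) Pₙ₋₂. -/
noncomputable def qP : ℕ → Polynomial ℤ
  | 0 => 0
  | 1 => 1
  | n + 2 => (1 + X ^ (n + 1)) * qP (n + 1) + X ^ n * qP n
/-- The Gaussian (q-)binomial coefficient [n choose m]_q ∈ ℤ[q], defined via the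
Pascal-type recurrence [n+1 choose m]_q = q^m [n choose m]_q + [n choose m-1]_q;
it equals ((1-q^n)⋯(1-q^(n-m+1)))/((1-q^m)⋯(1-q)) for 0 ≤ m ≤ n and is 0 for m > n. -/
noncomputable def qbinom : ℕ → ℕ → Polynomial ℤ
  | _, 0 => 1
  | 0, _ + 1 => 0
  | n + 1, m + 1 => X ^ (m + 1) * qbinom n (m + 1) + qbinom n m

theorem qb_zero (n : ℕ) : qbinom n 0 = 1 := by cases n <;> simp [qbinom]

theorem qb_succ (n m : ℕ) :
    qbinom (n + 1) (m + 1) = X ^ (m + 1) * qbinom n (m + 1) + qbinom n m := by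
  simp [qbinom]

theorem qb_lt (n : ℕ) : ∀ m, n < m → qbinom n m = 0 := by
  induction n with
  | zero => intro m h; obtain ⟨m, rfl⟩ := Nat.exists_eq_succ_of_ne_zero h.ne'; simp [qbinom]
  | succ n ih =>
    intro m h
    obtain ⟨m, rfl⟩ := Nat.exists_eq_succ_of_ne_zero (by omega : m ≠ 0)
    rw [Nat.succ_eq_add_one, qb_succ, ih _ (by omega), ih _ (by omega)]; simp

theorem qb_diff (m : ℕ) : ∀ j, X ^ (j + 1) * (qbinom (m + 1) (j + 1) - qbinom m (j + 1))
    = X ^ (m + 1) * qbinom m j := by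
  induction m with
  | zero => intro j; cases j <;> simp [qbinom]
  | succ m ih =>
    intro j
    cases j with
    | zero =>
      have h := ih 0
      rw [qb_succ (m + 1) 0, qb_succ m 0]
      rw [qb_succ m 0] at h
      simp only [qb_zero] at *
      linear_combination X * h
    | succ j =>
      have h1 := ih j
      have h2 := ih (j + 1)
      have e1 := qb_succ (m + 1) (j + 1)
      have e2 := qb_succ m (j + 1)
      have e3 := qb_succ m j
      linear_combination X ^ (j + 2) * h2 + X * h1 + X ^ (j + 2) * e1 - X ^ (j + 2) * e2
        - X ^ (m + 2) * e3

/-- the summand -/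
noncomputable def TT (n j k : ℕ) : Polynomial ℤ :=
  X ^ ((j + 1).choose 2 + k.choose 2) * qbinom j k * qbinom (n - k) j

theorem TT_zero (n j k : ℕ) (h : j < k ∨ n < k + j) : TT n j k = 0 := by
  unfold TT
  by_cases h1 : j < k
  · rw [qb_lt j k h1]; simp
  · rw [qb_lt (n - k) j (by omega)]; simp

theorem exp_eq (j k : ℕ) : (j ^ 2 + j + k ^ 2 - k) / 2 = (j + 1).choose 2 + k.choose 2 := by
  have h1 : (j + 1).choose 2 * 2 = j ^ 2 + j := by
    induction j with
    | zero => simp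
    | succ j ih => rw [Nat.choose_succ_succ' (j + 1) 1, Nat.choose_one_right]; linarith
  have h2 : k.choose 2 * 2 + k = k ^ 2 := by
    clear h1
    induction k with
    | zero => simp
    | succ k ih => rw [Nat.choose_succ_succ' k 1, Nat.choose_one_right]; linarith
  omega

noncomputable def SS (n : ℕ) : Polynomial ℤ :=
  ∑ k ∈ Finset.range (n + 1), ∑ j ∈ Finset.range (n + 1), TT n j k

theorem SS_eq (n M N : ℕ) (hM : n + 1 ≤ M) (hN : n + 1 ≤ N) :
    SS n = ∑ k ∈ Finset.range M, ∑ j ∈ Finset.range N, TT n j k := by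
  unfold SS
  have h1 : ∀ k, ∑ j ∈ Finset.range (n + 1), TT n j k = ∑ j ∈ Finset.range N, TT n j k := by
    intro k
    apply Finset.sum_subset (by simpa using hN)
    intro j _ hj
    simp only [Finset.mem_range] at hj
    exact TT_zero _ _ _ (by omega)
  simp only [h1]
  apply Finset.sum_subset (by simpa using hM)
  intro k _ hk
  simp only [Finset.mem_range] at hk
  exact Finset.sum_eq_zero fun j _ => TT_zero _ _ _ (by omega)

theorem TT_diff (n j k : ℕ) (h : k < n + 2) : TT (n + 2) (j + 1) k - TT (n + 1) (j + 1) k =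
    X ^ ((j + 1).choose 2 + k.choose 2 + (n + 2 - k)) * qbinom (j + 1) k * qbinom (n + 1 - k) j := by
  unfold TT
  have e : n + 2 - k = (n + 1 - k) + 1 := by omega
  have c : (j + 1 + 1).choose 2 = (j + 1) + (j + 1).choose 2 := by
    rw [Nat.choose_succ_succ' (j + 1) 1, Nat.choose_one_right]
  rw [e, c]
  have := qb_diff (n + 1 - k) j
  simp only [pow_add _ (j + 1 + _), pow_add _ (j + 1) (Nat.choose _ _), pow_add _ (Nat.choose _ _),
    pow_add _ (_ + _) (Nat.choose _ _), pow_add _ (_ + _) (_ + 1)] at *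
  linear_combination X ^ ((j + 1).choose 2) * X ^ (k.choose 2) * qbinom (j + 1) k * this

theorem D_zero (n j : ℕ) :
    X ^ ((j + 1).choose 2 + (0 : ℕ).choose 2 + (n + 2 - 0)) * qbinom (j + 1) 0
      * qbinom (n + 1 - 0) j = X ^ (n + 2) * TT (n + 1) j 0 := by
  unfold TT
  simp only [qb_zero, Nat.sub_zero]
  ring

theorem D_succ (n j k : ℕ) (h : k < n + 1) :
    X ^ ((j + 1).choose 2 + (k + 1).choose 2 + (n + 2 - (k + 1))) * qbinom (j + 1) (k + 1)
      * qbinom (n + 1 - (k + 1)) j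
      = X ^ (n + 2) * TT (n + 1) j (k + 1) + X ^ (n + 1) * TT n j k := by
  unfold TT
  have c : (k + 1).choose 2 = k + k.choose 2 := by
    rw [Nat.choose_succ_succ' k 1, Nat.choose_one_right]
  obtain ⟨d, rfl⟩ : ∃ d, n = k + d := ⟨n - k, by omega⟩
  rw [c, qb_succ, show k + d + 2 - (k + 1) = d + 1 by omega,
    show k + d + 1 - (k + 1) = d by omega, show k + d - k = d by omega]
  ring

theorem SS_rec (n : ℕ) : SS (n + 2) = (1 + X ^ (n + 2)) * SS (n + 1) + X ^ (n + 1) * SS n := by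
  have h2 : SS (n + 2) = ∑ k ∈ Finset.range (n + 2), ∑ j ∈ Finset.range (n + 3), TT (n + 2) j k := by
    unfold SS
    rw [Finset.sum_range_succ, add_eq_left]
    exact Finset.sum_eq_zero fun j _ => TT_zero _ _ _ (by omega)
  have h1 := SS_eq (n + 1) (n + 2) (n + 3) (by omega) (by omega)
  have h1' := SS_eq (n + 1) (n + 2) (n + 2) (by omega) (by omega)
  have h0 := SS_eq n (n + 1) (n + 2) (by omega) (by omega)
  have key : SS (n + 2) - SS (n + 1) = X ^ (n + 2) * SS (n + 1) + X ^ (n + 1) * SS n := by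
    rw [h2]
    conv_lhs => rw [h1]
    rw [h1', h0, ← Finset.sum_sub_distrib]
    have : ∀ k ∈ Finset.range (n + 2), ∑ j ∈ Finset.range (n + 3), TT (n + 2) j k
        - ∑ j ∈ Finset.range (n + 3), TT (n + 1) j k = ∑ j ∈ Finset.range (n + 2),
        X ^ ((j + 1).choose 2 + k.choose 2 + (n + 2 - k)) * qbinom (j + 1) k
          * qbinom (n + 1 - k) j := by
      intro k hk
      rw [← Finset.sum_sub_distrib, Finset.sum_range_succ']
      have z : TT (n + 2) 0 k - TT (n + 1) 0 k = 0 := by simp [TT, qb_zero]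
      rw [z, add_zero]
      exact Finset.sum_congr rfl fun j _ => TT_diff n j k (Finset.mem_range.1 hk)
    rw [Finset.sum_congr rfl this, Finset.sum_range_succ',
      Finset.sum_range_succ' (fun k => ∑ j ∈ Finset.range (n + 2), TT (n + 1) j k)]
    rw [Finset.sum_congr rfl (fun j _ => D_zero n j)]
    rw [Finset.sum_congr rfl (fun k hk => Finset.sum_congr rfl
      (fun j _ => D_succ n j k (Finset.mem_range.1 hk)))]
    simp only [Finset.sum_add_distrib, ← Finset.mul_sum]
    ring
  linear_combination key

theorem qP_SS (n : ℕ) : qP (n + 1) = SS n ∧ qP (n + 2) = SS (n + 1) := by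
  induction n with
  | zero =>
    constructor
    · simp [qP, SS, TT, qbinom]
    · simp [qP, SS, TT, qbinom, Finset.sum_range_succ]
  | succ n ih =>
    refine ⟨ih.2, ?_⟩
    rw [SS_rec, ← ih.1, ← ih.2, qP]

/-- For n ≥ 0, P_{n+1}(q) = Σ_{j=0}^n Σ_{k=0}^j q^((j²+j+k²−k)/2) [j choose k]_q [n−k choose j]_q. -/
theorem qPell_double_sum_formula (n : ℕ) :
    qP (n + 1) = ∑ j ∈ Finset.range (n + 1), ∑ k ∈ Finset.range (j + 1),
      X ^ ((j ^ 2 + j + k ^ 2 - k) / 2) * qbinom j k * qbinom (n - k) j := by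
  rw [(qP_SS n).1, SS, Finset.sum_comm]
  apply Finset.sum_congr rfl
  intro j hj
  rw [Finset.mem_range] at hj
  symm
  simp only [exp_eq]
  apply Finset.sum_subset (by simpa using hj)
  intro k _ hk
  simp only [Finset.mem_range] at hk
  exact TT_zero _ _ _ (by omega)
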